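/- Let G = Θ(l_1,…,l_n) be a Generalized Theta graph with n ≥ 2, l_1 = min_{i∈[n]} l_i ≥ 1, and l_i ≥ 2 for all i ∈ [n] − {1}. If l_1,…,l_n all have the same parity, then P*_DP(G,m) = P(G,m) for all m ≥ 2. -/

import Mathlib

open Finset

/-- An `m`-fold cover `𝓗 = (L, H)` of `G`, represented (up to isomorphism) on the vertex set
`V × Fin m`, with `L v = {v} × Fin m`.  The fields record that each part `L v` induces a
clique in `H`, that cross-edges occur only over edges of `G`, and that the cross-edges
between two parts form a (possibly empty) matching. -/
structure DPCover {V : Type*} (G : SimpleGraph V) (m : ℕ) where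
  H : SimpleGraph (V × Fin m)
  fiber_clique : ∀ (v : V) (a b : Fin m), a ≠ b → H.Adj (v, a) (v, b)
  cross_only_edges : ∀ (u v : V) (a b : Fin m), u ≠ v → H.Adj (u, a) (v, b) → G.Adj u v
  cross_matching : ∀ (u v : V), u ≠ v → ∀ (a b b' : Fin m),
    H.Adj (u, a) (v, b) → H.Adj (u, a) (v, b') → b = b'

/-- A full `m`-fold cover: every matching between `L u` and `L v` for `uv ∈ E(G)` is perfect. -/
def DPCover.IsFull {V : Type*} {G : SimpleGraph V} {m : ℕ} (C : DPCover G m) : Prop :=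
  ∀ (u v : V), G.Adj u v → ∀ a : Fin m, ∃ b : Fin m, C.H.Adj (u, a) (v, b)

/-- `P_DP(G, 𝓗)`: the number of `𝓗`-colorings of `G`, i.e. of independent sets in `H` of size
`|V(G)|` (equivalently, of independent transversals of the parts `L v`). -/
noncomputable def DPCover.count {V : Type*} {G : SimpleGraph V} {m : ℕ} (C : DPCover G m) : ℕ :=
  Nat.card {c : V → Fin m // ∀ u v : V, u ≠ v → ¬ C.H.Adj (u, c u) (v, c v)}

/-- The DP color function `P_DP(G, m)`: the minimum of `P_DP(G, 𝓗)` over all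
`m`-fold covers `𝓗` of `G`. -/
noncomputable def PDP {V : Type*} (G : SimpleGraph V) (m : ℕ) : ℕ :=
  sInf (Set.range fun C : DPCover G m => C.count)

/-- The dual DP color function `P*_DP(G, m)`: the maximum of `P_DP(G, 𝓗)` over all full
`m`-fold covers `𝓗` of `G`. -/
noncomputable def PDPdual {V : Type*} (G : SimpleGraph V) (m : ℕ) : ℕ :=
  sSup {k : ℕ | ∃ C : DPCover G m, C.IsFull ∧ C.count = k}

/-- The chromatic polynomial `P(G, m)`: the number of proper colorings of `G` with colors
from `{1, …, m}`. -/
noncomputable def chromP {V : Type*} (G : SimpleGraph V) (m : ℕ) : ℕ :=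
  Nat.card {c : V → Fin m // ∀ u v : V, G.Adj u v → c u ≠ c v}

/-- Vertices of the generalized theta graph `Θ(l 0, …, l (n-1))`: two end vertices
`u = Sum.inl false` and `w = Sum.inl true`, and internal vertices `(i, j)` with
`j ∈ {0, …, l i - 2}` for the `i`-th path (listed along the path from `u` to `w`). -/
abbrev ThetaV {n : ℕ} (l : Fin n → ℕ) : Type :=
  Bool ⊕ (Σ i : Fin n, Fin (l i - 1))

/-- The relation generating the edges of the generalized theta graph. -/
def thetaRel {n : ℕ} (l : Fin n → ℕ) : ThetaV l → ThetaV l → Prop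
  | Sum.inl _, Sum.inl _ => ∃ i, l i = 1
  | Sum.inl a, Sum.inr ⟨i, j⟩ => (a = false ∧ (j : ℕ) = 0) ∨ (a = true ∧ (j : ℕ) = l i - 2)
  | Sum.inr _, Sum.inl _ => False
  | Sum.inr ⟨i, j⟩, Sum.inr ⟨i', j'⟩ => i = i' ∧ (j' : ℕ) = (j : ℕ) + 1

/-- The generalized theta graph `Θ(l 0, …, l (n-1))`: two end vertices `u` and `w` joined by
`n` internally disjoint paths, the `i`-th of length `l i`. -/
def thetaGraph {n : ℕ} (l : Fin n → ℕ) : SimpleGraph (ThetaV l) :=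
  SimpleGraph.fromRel (thetaRel l)

/-- The end vertex `u`. -/
def thetaU {n : ℕ} (l : Fin n → ℕ) : ThetaV l := Sum.inl false

/-- The end vertex `w`. -/
def thetaW {n : ℕ} (l : Fin n → ℕ) : ThetaV l := Sum.inl true

/-- The sum over `b` of a product of nonnegative two-valued factors, each deviating by the same
amount `ε` at a single point, is largest when all the exceptional points coincide. -/
lemma sum_prod_add_ite_le {ι α : Type*} [Fintype α] [DecidableEq α] (S : Finset ι)
    (y : ι → ℤ) (ε : ℤ) (hy : ∀ i, 0 ≤ y i) (hx : ∀ i, 0 ≤ y i + ε) (s : ι → α) (t : α) :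
    ∑ b, ∏ i ∈ S, (y i + if b = s i then ε else 0) ≤
      ∑ b, ∏ i ∈ S, (y i + if b = t then ε else 0) := by
  classical
  have step : ∀ (F : α → ℤ) (z : ℤ) (p : α),
      ∑ b, (z + if b = p then ε else 0) * F b = z * ∑ b, F b + ε * F p := by
    intro F z p
    simp [add_mul, Finset.sum_add_distrib, Finset.mul_sum]
  induction S using Finset.induction_on with
  | empty => simp
  | insert j S hj ih =>
    simp only [Finset.prod_insert hj]
    rw [step (fun b => ∏ i ∈ S, (y i + if b = s i then ε else 0)),
      step (fun b => ∏ i ∈ S, (y i + if b = t then ε else 0))]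
    refine add_le_add (mul_le_mul_of_nonneg_left ih (hy j)) ?_
    simp only [if_true]
    rcases le_total 0 ε with h | h
    · refine mul_le_mul_of_nonneg_left (Finset.prod_le_prod (fun i _ => ?_) fun i _ => ?_) h
      all_goals have := hx i; have := hy i; (try split_ifs) <;> linarith
    · refine mul_le_mul_of_nonpos_left (Finset.prod_le_prod (fun i _ => ?_) fun i _ => ?_) h
      all_goals have := hx i; have := hy i; (try split_ifs) <;> linarith

/-- The number of ways to color the `k` internal vertices of a path with `m` colors when the
colors of the two end vertices are fixed and distinct. -/
def pathOff (m : ℤ) : ℕ → ℤ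
  | 0 => 1
  | k + 1 => (m - 1) * pathOff m k + (-1) ^ (k + 1)

lemma pathOff_nonneg {m : ℤ} (hm : 2 ≤ m) (k : ℕ) :
    0 ≤ pathOff m k ∧ 0 ≤ pathOff m k + (-1) ^ (k + 1) := by
  induction k with
  | zero => simp [pathOff]
  | succ k ih =>
    obtain ⟨h1, h2⟩ := ih
    have h3 : 0 ≤ (m - 2) * pathOff m k := mul_nonneg (by linarith) h1
    simp only [pathOff, pow_succ] at *
    constructor <;> linarith

/-- The composition of the permutations along a path. -/
def pathPerm {α : Type*} : (k : ℕ) → (Fin (k + 1) → Equiv.Perm α) → Equiv.Perm α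
  | 0, σ => σ 0
  | k + 1, σ => pathPerm k (fun j => σ j.succ) * σ 0

lemma pathPerm_one {α : Type*} (k : ℕ) :
    pathPerm k (fun _ => (1 : Equiv.Perm α)) = 1 := by
  induction k with
  | zero => rfl
  | succ k ih => simp [pathPerm, ih]

/-- The sequence `a, g 0, …, g (k - 1), b`. -/
def pathSeq {α : Type*} {k : ℕ} (a b : α) (g : Fin k → α) : Fin (k + 2) → α :=
  Fin.cons a (Fin.snoc (α := fun _ => α) g b : Fin (k + 1) → α)

lemma comp_pathSeq {α β : Type*} {k : ℕ} (f : α → β) (a b : α) (g : Fin k → α) (j : Fin (k + 2)) :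
    f (pathSeq a b g j) = pathSeq (f a) (f b) (fun j => f (g j)) j := by
  refine Fin.cases rfl (fun j => ?_) j
  refine Fin.lastCases ?_ (fun j => ?_) j <;> simp [pathSeq]

lemma pathSeq_cons {α : Type*} {k : ℕ} (a b x : α) (g : Fin k → α) (j : Fin (k + 2)) :
    pathSeq a b (Fin.cons x g : Fin (k + 1) → α) j.succ = pathSeq x b g j := by
  simp only [pathSeq, Fin.cons_succ]
  rw [← Fin.cons_snoc_eq_snoc_cons]

/-- The colorings of the internal vertices of a path, with end colors `a` and `b`, that avoid
the matchings given by the permutations `σ`. -/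
def PathOk {α : Type*} {k : ℕ} (σ : Fin (k + 1) → Equiv.Perm α) (a b : α) (g : Fin k → α) : Prop :=
  ∀ j : Fin (k + 1), pathSeq a b g j.succ ≠ σ j (pathSeq a b g j.castSucc)

lemma pathOk_cons {α : Type*} {k : ℕ} (σ : Fin (k + 2) → Equiv.Perm α) (a b x : α)
    (g : Fin k → α) :
    PathOk σ a b (Fin.cons x g : Fin (k + 1) → α) ↔
      x ≠ σ 0 a ∧ PathOk (fun j => σ j.succ) x b g := by
  unfold PathOk
  rw [Fin.forall_fin_succ]
  refine and_congr ?_ (forall_congr' fun j => ?_)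
  · rw [pathSeq_cons]; rfl
  · rw [pathSeq_cons, ← Fin.succ_castSucc, pathSeq_cons]

lemma card_pathOk {α : Type*} [Fintype α] [DecidableEq α] (k : ℕ)
    (σ : Fin (k + 1) → Equiv.Perm α) (a b : α) :
    (Nat.card {g : Fin k → α // PathOk σ a b g} : ℤ) =
      pathOff (Fintype.card α) k + if b = pathPerm k σ a then (-1) ^ (k + 1) else 0 := by
  induction k generalizing a with
  | zero =>
    have h : ∀ g : Fin 0 → α, PathOk σ a b g ↔ b ≠ σ 0 a := fun g => by
      unfold PathOk
      exact Fin.forall_fin_one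
    simp only [h, pathOff, pathPerm]
    split_ifs with hb <;> simp [hb]
  | succ k ih =>
    have e : {g : Fin (k + 1) → α // PathOk σ a b g} ≃
        Σ x : {x : α // x ≠ σ 0 a}, {g : Fin k → α // PathOk (fun j => σ j.succ) x.1 b g} :=
      { toFun := fun g =>
          have h := (pathOk_cons σ a b (g.1 0) (Fin.tail g.1)).1
            (by rw [Fin.cons_self_tail]; exact g.2)
          ⟨⟨g.1 0, h.1⟩, ⟨Fin.tail g.1, h.2⟩⟩
        invFun := fun p => ⟨Fin.cons p.1.1 p.2.1, (pathOk_cons σ a b _ _).2 ⟨p.1.2, p.2.2⟩⟩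
        left_inv := fun g => Subtype.ext (Fin.cons_self_tail g.1)
        right_inv := fun p => rfl }
    rw [Nat.card_congr e, Nat.card_sigma]
    push_cast
    simp only [ih]
    rw [← Finset.sum_subtype (Finset.univ.erase (σ 0 a)) (by simp) (fun x =>
        pathOff (Fintype.card α) k +
          if b = pathPerm k (fun j => σ j.succ) x then (-1) ^ (k + 1) else 0),
      Finset.sum_erase_eq_sub (Finset.mem_univ _), Finset.sum_add_distrib]
    have hsum : ∑ x, (if b = pathPerm k (fun j => σ j.succ) x then (-1 : ℤ) ^ (k + 1) else 0) =
        (-1) ^ (k + 1) := by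
      have : ∀ x, b = pathPerm k (fun j => σ j.succ) x ↔
          x = (pathPerm k (fun j => σ j.succ)).symm b := fun x => by
        rw [Equiv.eq_symm_apply, eq_comm]
      simp [this]
    rw [hsum]
    have hperm : pathPerm (k + 1) σ a = pathPerm k (fun j => σ j.succ) (σ 0 a) := rfl
    rw [hperm]
    simp only [pathOff, Finset.sum_const, Finset.card_univ, nsmul_eq_mul]
    by_cases hb : b = pathPerm k (fun j => σ j.succ) (σ 0 a)
    · rw [if_pos hb, if_pos hb]; ring
    · rw [if_neg hb, if_neg hb]; ring

section Theta

variable {n : ℕ} {l : Fin n → ℕ}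

/-- The `j`-th vertex of the `i`-th path, from `u` to `w`. -/
def thetaPos (l : Fin n → ℕ) (i : Fin n) : Fin (l i - 1 + 2) → ThetaV l :=
  pathSeq (Sum.inl false) (Sum.inl true) (fun j => Sum.inr ⟨i, j⟩)

lemma thetaPos_zero (i : Fin n) : thetaPos l i 0 = Sum.inl false := rfl

lemma thetaPos_inner (i : Fin n) (j : Fin (l i - 1)) :
    thetaPos l i j.castSucc.succ = Sum.inr ⟨i, j⟩ := by
  simp [thetaPos, pathSeq]

lemma thetaPos_last (i : Fin n) : thetaPos l i (Fin.last _) = Sum.inl true := by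
  rw [← Fin.succ_last]
  simp [thetaPos, pathSeq]

lemma thetaPos_adj (hl : ∀ i, 1 ≤ l i) (i : Fin n) (j : Fin (l i - 1 + 1)) :
    (thetaGraph l).Adj (thetaPos l i j.castSucc) (thetaPos l i j.succ) := by
  have hi := hl i
  rw [thetaGraph, SimpleGraph.fromRel_adj]
  by_cases hk : l i - 1 = 0
  · have h0 : j.castSucc = 0 := Fin.ext (by simp; omega)
    have h1 : j.succ = Fin.last _ := Fin.ext (by simp; omega)
    rw [h0, h1, thetaPos_zero, thetaPos_last]
    exact ⟨by simp, Or.inl ⟨i, by omega⟩⟩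
  by_cases hj : (j : ℕ) = 0
  · have h0 : j.castSucc = 0 := Fin.ext (by simp [hj])
    have h1 : j.succ = (⟨0, by omega⟩ : Fin (l i - 1)).castSucc.succ := Fin.ext (by simp [hj])
    rw [h0, h1, thetaPos_zero, thetaPos_inner]
    exact ⟨by simp, Or.inl (Or.inl ⟨rfl, rfl⟩)⟩
  have h0 : j.castSucc = (⟨j - 1, by omega⟩ : Fin (l i - 1)).castSucc.succ :=
    Fin.ext (by simp; omega)
  by_cases hj' : (j : ℕ) = l i - 1
  · have h1 : j.succ = Fin.last _ := Fin.ext (by simp; omega)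
    rw [h0, h1, thetaPos_inner, thetaPos_last]
    exact ⟨by simp, Or.inr (Or.inr ⟨rfl, by simp; omega⟩)⟩
  · have h1 : j.succ = (⟨j, by omega⟩ : Fin (l i - 1)).castSucc.succ := Fin.ext (by simp)
    rw [h0, h1, thetaPos_inner, thetaPos_inner]
    exact ⟨by simp; omega, Or.inl ⟨rfl, by simp; omega⟩⟩

lemma exists_thetaPos_of_thetaRel {x y : ThetaV l} (hne : x ≠ y)
    (h : thetaRel l x y) :
    ∃ i, ∃ j : Fin (l i - 1 + 1),
      (x = thetaPos l i j.castSucc ∧ y = thetaPos l i j.succ) ∨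
      (y = thetaPos l i j.castSucc ∧ x = thetaPos l i j.succ) := by
  rcases x with a | ⟨i, j⟩ <;> rcases y with b | ⟨i', j'⟩
  · obtain ⟨i, hi⟩ := h
    have h1 : (Fin.last (l i - 1)).castSucc = (0 : Fin (l i - 1 + 2)) :=
      Fin.ext (by simp; omega)
    refine ⟨i, Fin.last _, ?_⟩
    rw [Fin.succ_last, h1, thetaPos_zero, thetaPos_last]
    cases a <;> cases b <;> simp_all
  · rcases h with ⟨rfl, h⟩ | ⟨rfl, h⟩
    · refine ⟨i', j'.castSucc, Or.inl ⟨?_, (thetaPos_inner _ _).symm⟩⟩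
      have : j'.castSucc.castSucc = 0 := Fin.ext (by simp [h])
      rw [this, thetaPos_zero]
    · refine ⟨i', Fin.last _, Or.inr ⟨?_, by rw [Fin.succ_last, thetaPos_last]⟩⟩
      have : (Fin.last (l i' - 1)).castSucc = j'.castSucc.succ :=
        Fin.ext (by have := j'.2; simp; omega)
      rw [this, thetaPos_inner]
  · exact h.elim
  · obtain ⟨rfl, h⟩ := h
    refine ⟨i, j'.castSucc, Or.inl ⟨?_, (thetaPos_inner _ _).symm⟩⟩
    have : j'.castSucc.castSucc = j.castSucc.succ := Fin.ext (by simp [h])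
    rw [this, thetaPos_inner]

/-- A symmetric relation holds along all edges of a generalized theta graph as soon as it holds
along the edges of each path, traversed from `u` to `w`. -/
lemma forall_thetaGraph_adj_iff (hl : ∀ i, 1 ≤ l i) {R : ThetaV l → ThetaV l → Prop}
    (hR : ∀ x y, R x y → R y x) :
    (∀ x y, (thetaGraph l).Adj x y → R x y) ↔
      ∀ i, ∀ j : Fin (l i - 1 + 1), R (thetaPos l i j.castSucc) (thetaPos l i j.succ) := by
  refine ⟨fun h i j => h _ _ (thetaPos_adj hl i j), fun h => ?_⟩
  have key : ∀ x y, x ≠ y → thetaRel l x y → R x y := by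
    intro x y hne hxy
    obtain ⟨i, j, ⟨rfl, rfl⟩ | ⟨rfl, rfl⟩⟩ := exists_thetaPos_of_thetaRel hne hxy
    · exact h i j
    · exact hR _ _ (h i j)
  rintro x y hxy
  rw [thetaGraph, SimpleGraph.fromRel_adj] at hxy
  obtain ⟨hne, hxy | hxy⟩ := hxy
  · exact key x y hne hxy
  · exact hR _ _ (key y x hne.symm hxy)

/-- The number of colorings of a generalized theta graph avoiding the matchings given by
permutations along its paths. -/
lemma card_theta_colorings {α : Type*} [Fintype α] [DecidableEq α]
    (σ : ∀ i, Fin (l i - 1 + 1) → Equiv.Perm α) :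
    (Nat.card {c : ThetaV l → α //
        ∀ i, ∀ j, c (thetaPos l i j.succ) ≠ σ i j (c (thetaPos l i j.castSucc))} : ℤ) =
      ∑ a, ∑ b, ∏ i, (pathOff (Fintype.card α) (l i - 1) +
        if b = pathPerm (l i - 1) (σ i) a then (-1) ^ (l i - 1 + 1) else 0) := by
  have e : {c : ThetaV l → α //
        ∀ i, ∀ j, c (thetaPos l i j.succ) ≠ σ i j (c (thetaPos l i j.castSucc))} ≃
      Σ p : α × α, ∀ i, {g : Fin (l i - 1) → α // PathOk (σ i) p.1 p.2 g} :=
    { toFun := fun c => ⟨(c.1 (Sum.inl false), c.1 (Sum.inl true)), fun i =>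
        ⟨fun j => c.1 (Sum.inr ⟨i, j⟩), fun j => by
          have := c.2 i j
          simpa only [thetaPos, comp_pathSeq c.1] using this⟩⟩
      invFun := fun p => ⟨Sum.elim (fun t => cond t p.1.2 p.1.1) (fun q => (p.2 q.1).1 q.2),
        fun i j => by
          have := (p.2 i).2 j
          simp only [thetaPos, comp_pathSeq (Sum.elim (fun t => cond t p.1.2 p.1.1)
            (fun q : Σ i, Fin (l i - 1) => (p.2 q.1).1 q.2))]
          exact this⟩
      left_inv := fun c => Subtype.ext <| funext fun x => by
        rcases x with (_ | _) | _ <;> rfl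
      right_inv := fun p => rfl }
  rw [Nat.card_congr e, Nat.card_sigma, Fintype.sum_prod_type]
  simp only [Nat.card_pi]
  push_cast
  simp only [card_pathOk]

end Theta

/-- The cover of `G` in which every matching is the identity. -/
def DPCover.trivial {V : Type*} (G : SimpleGraph V) (m : ℕ) : DPCover G m where
  H :=
    { Adj := fun p q => (p.1 = q.1 ∧ p.2 ≠ q.2) ∨ (G.Adj p.1 q.1 ∧ p.2 = q.2)
      symm := ⟨fun p q h => h.imp (fun h => ⟨h.1.symm, h.2.symm⟩)
        (fun h => ⟨h.1.symm, h.2.symm⟩)⟩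
      loopless := ⟨fun p h => by simp at h⟩ }
  fiber_clique := fun v a b h => Or.inl ⟨rfl, h⟩
  cross_only_edges := fun u v a b huv h => by
    rcases h with h | h
    · exact (huv h.1).elim
    · exact h.1
  cross_matching := fun u v huv a b b' h h' => by
    rcases h with h | h
    · exact (huv h.1).elim
    rcases h' with h' | h'
    · exact (huv h'.1).elim
    exact h.2.symm.trans h'.2

lemma DPCover.trivial_isFull {V : Type*} (G : SimpleGraph V) (m : ℕ) :
    (DPCover.trivial G m).IsFull :=
  fun _ _ h a => ⟨a, Or.inr ⟨h, rfl⟩⟩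

lemma DPCover.trivial_count {V : Type*} (G : SimpleGraph V) (m : ℕ) :
    (DPCover.trivial G m).count = chromP G m := by
  refine Nat.card_congr (Equiv.subtypeEquivRight fun c => forall₂_congr fun u v => ?_)
  simp only [DPCover.trivial]
  by_cases h : u = v
  · subst h; simp
  · simp [h]

/-- Over each edge, the perfect matching of a full cover is given by a permutation. -/
lemma DPCover.IsFull.exists_perm {V : Type*} {G : SimpleGraph V} {m : ℕ} {C : DPCover G m}
    (hC : C.IsFull) {u v : V} (h : G.Adj u v) :
    ∃ σ : Equiv.Perm (Fin m), ∀ a b, C.H.Adj (u, a) (v, b) ↔ b = σ a := by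
  choose f hf using hC u v h
  have hinj : Function.Injective f := fun a a' haa' =>
    C.cross_matching v u h.ne' (f a) a a' (hf a).symm (haa' ▸ (hf a').symm)
  refine ⟨Equiv.ofBijective f (Finite.injective_iff_bijective.1 hinj),
    fun a b => ⟨fun hab => ?_, ?_⟩⟩
  · exact C.cross_matching u v h.ne a b (f a) hab (hf a)
  · rintro rfl
    exact hf a

lemma DPCover.forall_ne_iff {V : Type*} {G : SimpleGraph V} {m : ℕ} (C : DPCover G m)
    (c : V → Fin m) :
    (∀ u v, u ≠ v → ¬ C.H.Adj (u, c u) (v, c v)) ↔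
      ∀ u v, G.Adj u v → ¬ C.H.Adj (u, c u) (v, c v) :=
  ⟨fun h u v huv => h u v huv.ne,
    fun h u v huv hadj => h u v (C.cross_only_edges u v _ _ huv hadj) hadj⟩

lemma DPCover.IsFull.count_theta_le {n : ℕ} {l : Fin n → ℕ} (hl : ∀ i, 1 ≤ l i) {r : ℕ}
    (hpar : ∀ i, l i % 2 = r % 2) {m : ℕ} (hm : 2 ≤ m) {C : DPCover (thetaGraph l) m}
    (hC : C.IsFull) : C.count ≤ chromP (thetaGraph l) m := by
  choose σ hσ using fun i j => hC.exists_perm (thetaPos_adj hl i j)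
  have hcount : C.count = Nat.card {c : ThetaV l → Fin m //
      ∀ i, ∀ j, c (thetaPos l i j.succ) ≠ σ i j (c (thetaPos l i j.castSucc))} := by
    refine Nat.card_congr (Equiv.subtypeEquivRight fun c => ?_)
    rw [C.forall_ne_iff, forall_thetaGraph_adj_iff hl (fun x y h h' => h h'.symm)]
    simp only [hσ, ne_eq]
  have hchrom : chromP (thetaGraph l) m = Nat.card {c : ThetaV l → Fin m //
      ∀ i, ∀ j, c (thetaPos l i j.succ) ≠
        (fun (i : Fin n) (_ : Fin (l i - 1 + 1)) => (1 : Equiv.Perm (Fin m))) i j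
          (c (thetaPos l i j.castSucc))} := by
    refine Nat.card_congr (Equiv.subtypeEquivRight fun c => ?_)
    rw [forall_thetaGraph_adj_iff hl (fun x y h => h.symm)]
    simp only [Equiv.Perm.coe_one, id_eq, ne_comm]
  have hm' : (2 : ℤ) ≤ Fintype.card (Fin m) := by simpa using hm
  have hε : ∀ i, (-1 : ℤ) ^ (l i - 1 + 1) = (-1) ^ r := fun i => by
    rw [Nat.sub_add_cancel (hl i), neg_one_pow_eq_pow_mod_two, hpar i,
      ← neg_one_pow_eq_pow_mod_two]
  rw [← Nat.cast_le (α := ℤ), hcount, hchrom, card_theta_colorings, card_theta_colorings]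
  simp only [hε, pathPerm_one, Equiv.Perm.coe_one, id_eq]
  refine Finset.sum_le_sum fun a _ => sum_prod_add_ite_le _ _ _
    (fun i => (pathOff_nonneg hm' _).1) (fun i => ?_) _ _
  rw [← hε i]
  exact (pathOff_nonneg hm' _).2

/-- Let `G = Θ(l_1,…,l_n)` with `n ≥ 2`, `l_1 = min l_i ≥ 1` and `l_i ≥ 2`
for `i ≠ 1`.  If `l_1, …, l_n` all have the same parity, then `P*_DP(G,m) = P(G,m)` for all
`m ≥ 2`. -/
theorem statement16 {n : ℕ} (hn : 2 ≤ n) (l : Fin n → ℕ)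
    (hmin : ∀ i : Fin n, l ⟨0, by omega⟩ ≤ l i)
    (hl1 : 1 ≤ l ⟨0, by omega⟩)
    (hli : ∀ i : Fin n, i ≠ ⟨0, by omega⟩ → 2 ≤ l i)
    (hpar : ∀ i : Fin n, l i % 2 = l ⟨0, by omega⟩ % 2) :
    ∀ m : ℕ, 2 ≤ m → PDPdual (thetaGraph l) m = chromP (thetaGraph l) m := by
  intro m hm
  have hl : ∀ i, 1 ≤ l i := fun i => hl1.trans (hmin i)
  exact IsGreatest.csSup_eq ⟨⟨DPCover.trivial _ m, DPCover.trivial_isFull _ m,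
    DPCover.trivial_count _ m⟩, fun _ ⟨_, hC, hk⟩ => hk ▸ hC.count_theta_le hl hpar hm⟩
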